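/- arXiv:2110.11758 — 7 statements merged into one kernel-verified Lean document; each statement's English description precedes it below -/
import Mathlib

section
/- In any Crew instance in which every card has value 1 (k = 1), if O contains two objectives (c, i) and (c', i') assigned to distinct players i ≠ i', then no successful play sequence exists. -/
/-- A card is a pair (value, suit). -/
abbrev Card : Type := ℕ × ℕ

/-- A trick from state `st` led by `lead` with plays `play` is legal:
every hand is nonempty, each player plays a card from their own hand,
and every player follows the led suit if able. -/
def TrickOk {p : ℕ} (st : Fin p → Finset Card) (lead : Fin p) (play : Fin p → Card) : Prop :=
  (∀ i, (st i).Nonempty) ∧ (∀ i, play i ∈ st i) ∧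
  (∀ i, (play i).2 = (play lead).2 ∨ ∀ c ∈ st i, c.2 ≠ (play lead).2)

/-- Player `w` wins the trick: `w`'s card is of the led suit and strictly
beats every other card of the led suit. -/
def Wins {p : ℕ} (lead : Fin p) (play : Fin p → Card) (w : Fin p) : Prop :=
  (play w).2 = (play lead).2 ∧
  ∀ j, j ≠ w → (play j).2 = (play lead).2 → (play j).1 < (play w).1

/-- A played trick: its leader, the card played by each player, and its winner. -/
structure Trick (p : ℕ) where
  lead : Fin p
  play : Fin p → Card
  winner : Fin p

/-- After a trick, each played card is removed from its owner's hand. -/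
def nextState {p : ℕ} (st : Fin p → Finset Card) (play : Fin p → Card) :
    Fin p → Finset Card :=
  fun i => (st i).erase (play i)

/-- `PlaysFrom st lead L fin`: starting from hands `st` with `lead` to lead the
first trick, the list of tricks `L` is a legal play sequence ending in hands `fin`;
the winner of each trick leads the next. -/
inductive PlaysFrom {p : ℕ} :
    (Fin p → Finset Card) → Fin p → List (Trick p) → (Fin p → Finset Card) → Prop
  | nil (st : Fin p → Finset Card) (lead : Fin p) : PlaysFrom st lead [] st
  | cons {st : Fin p → Finset Card} {lead : Fin p} {play : Fin p → Card} {w : Fin p}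
      {rest : List (Trick p)} {fin : Fin p → Finset Card} :
      TrickOk st lead play → Wins lead play w →
      PlaysFrom (nextState st play) w rest fin →
      PlaysFrom st lead (⟨lead, play, w⟩ :: rest) fin

/-- Objective `o = (c, i)` is completed in trick `t` if card `c` is played in `t`
and player `i` wins `t`. -/
def Completes {p : ℕ} (t : Trick p) (o : Card × Fin p) : Prop :=
  (∃ j, t.play j = o.1) ∧ t.winner = o.2

instance {p : ℕ} (t : Trick p) (o : Card × Fin p) : Decidable (Completes t o) :=
  inferInstanceAs (Decidable ((∃ j, t.play j = o.1) ∧ t.winner = o.2))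

/-- A play sequence is successful if every objective is completed in some trick. -/
def Successful {p : ℕ} (O : Finset (Card × Fin p)) (L : List (Trick p)) : Prop :=
  ∀ o ∈ O, ∃ t ∈ L, Completes t o

/-- The structural conditions on a Crew instance: hands are pairwise disjoint
(cards are distinct), every objective card is in some hand, and no two
objectives share a card. -/
def ValidInstance {p : ℕ} (hand : Fin p → Finset Card) (O : Finset (Card × Fin p)) : Prop :=
  (∀ i j : Fin p, i ≠ j → Disjoint (hand i) (hand j)) ∧
  (∀ o ∈ O, ∃ i, o.1 ∈ hand i) ∧
  (∀ o ∈ O, ∀ q ∈ O, o.1 = q.1 → o = q)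

/-- The instance admits a successful play sequence (with an arbitrary first leader). -/
def HasSuccess {p : ℕ} (hand : Fin p → Finset Card) (O : Finset (Card × Fin p)) : Prop :=
  ∃ lead L fin, PlaysFrom hand lead L fin ∧ Successful O L

/-- When all played cards have the same value, only the leader can win the trick. -/
theorem Wins.eq_lead {p : ℕ} {lead w : Fin p} {play : Fin p → Card} {v : ℕ}
    (h : Wins lead play w) (hv : ∀ i, (play i).1 = v) : w = lead := by
  by_contra hw
  have hlt := h.2 lead (Ne.symm hw) rfl
  rw [hv, hv] at hlt
  exact lt_irrefl _ hlt

/-- When all cards have the same value, the first leader wins every trick. -/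
theorem PlaysFrom.winner_eq_lead {p : ℕ} {st fin : Fin p → Finset Card} {lead : Fin p}
    {L : List (Trick p)} {v : ℕ} (h : PlaysFrom st lead L fin)
    (hv : ∀ i, ∀ c ∈ st i, c.1 = v) : ∀ t ∈ L, t.winner = lead := by
  induction h with
  | nil => simp
  | cons hok hwin _ ih =>
    have hw := hwin.eq_lead fun i => hv i _ (hok.2.1 i)
    intro t ht
    rcases List.mem_cons.mp ht with rfl | ht
    · exact hw
    · exact (ih (fun i c hc => hv i c (Finset.mem_of_mem_erase hc)) t ht).trans hw

/-- In any Crew instance in which every card has value 1 (k = 1),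
if two objectives are assigned to distinct players, then no successful play
sequence exists. -/
theorem crew_single_value_two_owners_no_success {p : ℕ} (hp : 2 ≤ p)
    (hand : Fin p → Finset Card) (O : Finset (Card × Fin p))
    (hvalid : ValidInstance hand O)
    (hval : ∀ i : Fin p, ∀ c ∈ hand i, c.1 = 1)
    (o o' : Card × Fin p) (ho : o ∈ O) (ho' : o' ∈ O) (hne : o.2 ≠ o'.2) :
    ¬ HasSuccess hand O := by
  rintro ⟨lead, L, fin, hplay, hsucc⟩
  obtain ⟨t, ht, -, hto⟩ := hsucc o ho
  obtain ⟨t', ht', -, hto'⟩ := hsucc o' ho'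
  have hlead := hplay.winner_eq_lead hval
  exact hne (by rw [← hto, ← hto', hlead t ht, hlead t' ht'])
end

section
/- In any Crew instance in which all cards have the same suit (s = 1) and the card of every objective lies in the hand of the player assigned that objective, every trick of a play sequence completes at most one objective; consequently every successful play sequence consists of at least |O| tricks. -/
/-- Every card played during a play sequence lies in the initial hand of the player who plays it. -/
theorem PlaysFrom.play_mem {p : ℕ} {st fin : Fin p → Finset Card} {lead : Fin p}
    {L : List (Trick p)} (h : PlaysFrom st lead L fin) :
    ∀ t ∈ L, ∀ i, t.play i ∈ st i := by
  induction h with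
  | nil => simp
  | cons hok _ _ ih =>
    intro t ht i
    rcases List.mem_cons.mp ht with rfl | ht
    · exact hok.2.1 i
    · exact Finset.mem_of_mem_erase (ih t ht i)

/-- When hands are disjoint, a trick can complete an objective whose card is owned by its player
only if that card is the one played by the winner. -/
theorem Completes.play_winner {p : ℕ} {hand : Fin p → Finset Card} {t : Trick p}
    {o : Card × Fin p} (hdisj : ∀ i j : Fin p, i ≠ j → Disjoint (hand i) (hand j))
    (hplay : ∀ i, t.play i ∈ hand i) (howned : o.1 ∈ hand o.2) (h : Completes t o) :
    t.play t.winner = o.1 := by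
  obtain ⟨⟨j, hj⟩, hw⟩ := h
  have hjo : j = o.2 := by
    by_contra hne
    exact Finset.disjoint_left.mp (hdisj j o.2 hne) (hj ▸ hplay j) howned
  rw [hw, ← hjo, hj]

/-- If each trick completes at most one objective, a successful play sequence has at least as many
tricks as there are objectives. -/
theorem Successful.card_le_length {p : ℕ} {O : Finset (Card × Fin p)} {L : List (Trick p)}
    (hL : Successful O L)
    (hone : ∀ t ∈ L, ∀ o ∈ O, ∀ q ∈ O, Completes t o → Completes t q → o = q) :
    O.card ≤ L.length := by
  have hex : ∀ o : O, ∃ k : Fin L.length, Completes (L.get k) o := by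
    rintro ⟨o, ho⟩
    obtain ⟨t, ht, hc⟩ := hL o ho
    obtain ⟨k, rfl⟩ := List.get_of_mem ht
    exact ⟨k, hc⟩
  choose f hf using hex
  have hinj : Function.Injective f := fun o q hoq =>
    Subtype.ext (hone _ (L.get_mem (f o)) o o.2 q q.2 (hf o) (hoq ▸ hf q))
  simpa using Fintype.card_le_of_injective f hinj

/-- In any single-suit Crew instance whose objective cards are owned
by the players assigned to them, every trick completes at most one objective;
consequently every successful play sequence has at least |O| tricks. -/
theorem crew_owned_single_suit_one_objective_per_trick {p : ℕ} (hp : 2 ≤ p)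
    (hand : Fin p → Finset Card) (O : Finset (Card × Fin p))
    (hvalid : ValidInstance hand O)
    (hsuit : ∀ i : Fin p, ∀ c ∈ hand i, c.2 = 1)
    (howned : ∀ o ∈ O, o.1 ∈ hand o.2)
    (lead : Fin p) (L : List (Trick p)) (fin : Fin p → Finset Card)
    (hplays : PlaysFrom hand lead L fin) :
    (∀ t ∈ L, ∀ o ∈ O, ∀ q ∈ O, Completes t o → Completes t q → o = q) ∧
      (Successful O L → O.card ≤ L.length) := by
  have hone : ∀ t ∈ L, ∀ o ∈ O, ∀ q ∈ O, Completes t o → Completes t q → o = q := by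
    intro t ht o ho q hq hto htq
    have hplay := hplays.play_mem t ht
    exact hvalid.2.2 o ho q hq
      ((hto.play_winner hvalid.1 hplay (howned o ho)).symm.trans
        (htq.play_winner hvalid.1 hplay (howned q hq)))
  exact ⟨hone, fun hL => hL.card_le_length hone⟩
end

section
/- In any Crew instance in which all cards have the same suit (s = 1) and the card of every objective lies in the hand of the player assigned that objective, suppose some successful play sequence begins with a trick whose leader is the player assigned an objective (c, i) and who leads card c, and in which a non-leading player q plays a card b of value less than the value of c. If the hand of q contains a card a that is not the card of any objective and whose value lies strictly between the values of b and c, then there is also a successful play sequence whose first trick agrees with the original first trick except that player q plays a instead of b. -/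
theorem PlaysFrom.play_mem_and_wins {p : ℕ} {st fin : Fin p → Finset Card} {lead : Fin p}
    {L : List (Trick p)} (h : PlaysFrom st lead L fin) :
    ∀ t ∈ L, (∀ i, t.play i ∈ st i) ∧ Wins t.lead t.play t.winner := by
  induction h with
  | nil => simp
  | cons hok hwin _ ih =>
    intro t ht
    rcases List.mem_cons.1 ht with rfl | ht
    · exact ⟨hok.2.1, hwin⟩
    · exact ⟨fun i => Finset.mem_of_mem_erase ((ih t ht).1 i), (ih t ht).2⟩

theorem Wins.unique {p : ℕ} {lead w w' : Fin p} {play : Fin p → Card}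
    (h : Wins lead play w) (h' : Wins lead play w') : w = w' := by
  by_contra hne
  exact lt_asymm (h.2 w' (Ne.symm hne) h'.1) (h'.2 w hne h.1)

theorem exists_wins_of_injective {p : ℕ} (lead : Fin p) {play : Fin p → Card} {s : ℕ}
    (hinj : Function.Injective play) (hsuit : ∀ i, (play i).2 = s) :
    ∃ w, Wins lead play w := by
  have : Nonempty (Fin p) := ⟨lead⟩
  obtain ⟨w, hw⟩ := Finite.exists_max fun i => (play i).1
  refine ⟨w, by rw [hsuit, hsuit], fun j hj _ => lt_of_le_of_ne (hw j) fun h => hj ?_⟩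
  exact hinj (Prod.ext h (by rw [hsuit, hsuit]))

/-- In a single suit, relabelling the cards of a play sequence by a suit-preserving permutation
gives a play sequence, possibly with other winners. -/
theorem PlaysFrom.exists_relabel {p : ℕ} {st fin : Fin p → Finset Card} {lead : Fin p}
    {L : List (Trick p)} (h : PlaysFrom st lead L fin) {s : ℕ}
    (hsuit : ∀ i, ∀ c ∈ st i, c.2 = s) (hdisj : ∀ i j, i ≠ j → Disjoint (st i) (st j))
    (σ : Equiv.Perm Card) (hσ : ∀ c, c.2 = s → (σ c).2 = s) (lead' : Fin p) :
    ∃ L' fin', PlaysFrom (fun i => (st i).image σ) lead' L' fin' ∧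
      List.Forall₂ (fun t t' => t'.play = σ ∘ t.play) L L' := by
  induction h generalizing lead' with
  | nil => exact ⟨[], _, .nil _ _, .nil⟩
  | @cons st lead play w rest fin hok hwin _ ih =>
    have hplay : ∀ i, ((σ ∘ play) i).2 = s := fun i => hσ _ (hsuit i _ (hok.2.1 i))
    have hinj : Function.Injective play := fun i j hij => by
      by_contra hne
      exact Finset.disjoint_left.1 (hdisj i j hne) (hok.2.1 i) (hij ▸ hok.2.1 j)
    obtain ⟨w', hw'⟩ := exists_wins_of_injective lead' (σ.injective.comp hinj) hplay
    obtain ⟨L', fin', hL', hrel⟩ := ih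
      (fun i c hc => hsuit i c (Finset.mem_of_mem_erase hc))
      (fun i j hij => (hdisj i j hij).mono (Finset.erase_subset _ _) (Finset.erase_subset _ _)) w'
    have hnext : (fun i => (nextState st play i).image σ) =
        nextState (fun i => (st i).image σ) (σ ∘ play) := by
      funext i
      exact Finset.image_erase σ.injective _ _
    rw [hnext] at hL'
    exact ⟨_, fin', .cons ⟨fun i => (hok.1 i).image σ,
      fun i => Finset.mem_image_of_mem σ (hok.2.1 i),
      fun i => .inl ((hplay i).trans (hplay lead').symm)⟩ hw' hL', .cons rfl hrel⟩

/-- Single-suit, owned objectives. If a successful play sequence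
starts with a trick led by the owner of objective (c, i) who leads c, in which a
non-leading player q plays a card of value below that of c, and q holds a
non-objective card a of value strictly between the played card and c, then
there is a successful play sequence whose first trick is the same except that
q plays a. -/
theorem crew_owned_single_suit_improve_play {p : ℕ} (hp : 2 ≤ p)
    (hand : Fin p → Finset Card) (O : Finset (Card × Fin p))
    (hvalid : ValidInstance hand O)
    (hsuit : ∀ i : Fin p, ∀ c ∈ hand i, c.2 = 1)
    (howned : ∀ o ∈ O, o.1 ∈ hand o.2)
    (o : Card × Fin p) (ho : o ∈ O)
    (play : Fin p → Card) (w : Fin p) (rest : List (Trick p))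
    (fin : Fin p → Finset Card)
    (hleadcard : play o.2 = o.1)
    (hplays : PlaysFrom hand o.2 (⟨o.2, play, w⟩ :: rest) fin)
    (hsucc : Successful O (⟨o.2, play, w⟩ :: rest))
    (q : Fin p) (hq : q ≠ o.2) (hb : (play q).1 < o.1.1)
    (a : Card) (ha : a ∈ hand q) (hanotobj : a ∉ O.image Prod.fst)
    (hba : (play q).1 < a.1) (hac : a.1 < o.1.1) :
    ∃ w' rest' fin',
      PlaysFrom hand o.2 (⟨o.2, Function.update play q a, w'⟩ :: rest') fin' ∧
        Successful O (⟨o.2, Function.update play q a, w'⟩ :: rest') := by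
  have hmem := hplays.play_mem_and_wins
  have howner : ∀ {c i j}, c ∈ hand i → c ∈ hand j → i = j := fun {c i j} hi hj => by
    by_contra hne
    exact Finset.disjoint_left.1 (hvalid.1 i j hne) hi hj
  have hfirst : ∀ i, play i ∈ hand i := (hmem _ List.mem_cons_self).1
  have hrest : ∀ t ∈ rest, ∀ i j, t.play i ≠ play j := by
    cases hplays with
    | cons _ _ h =>
      intro t ht i j hij
      have hi := (h.play_mem_and_wins t ht).1 i
      have : i = j := howner (Finset.mem_of_mem_erase hi) (hij ▸ hfirst j)
      subst this
      exact Finset.ne_of_mem_erase hi hij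
  have hw : w = o.2 := by
    obtain ⟨t, ht, ⟨j, hj⟩, hwin⟩ := hsucc o ho
    rcases List.mem_cons.1 ht with rfl | ht
    · exact hwin
    · exact absurd (hj.trans hleadcard.symm) (hrest t ht j o.2)
  have hbobj : ∀ o' ∈ O, o'.1 ≠ play q := by
    intro o' ho' heq
    obtain ⟨t, ht, ⟨j, hj⟩, hwin⟩ := hsucc o' ho'
    rcases List.mem_cons.1 ht with rfl | ht
    · exact hq ((howner (hfirst q) (heq ▸ howned o' ho')).trans (hwin.symm.trans hw))
    · exact hrest t ht j q (hj.trans heq)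
  have haobj : ∀ o' ∈ O, o'.1 ≠ a := fun o' ho' h =>
    hanotobj (Finset.mem_image.2 ⟨o', ho', h⟩)
  let σ := Equiv.swap a (play q)
  have hσsuit : ∀ c : Card, c.2 = 1 → (σ c).2 = 1 := by
    intro c hc
    have h1 := hsuit q a ha
    have h2 := hsuit q _ (hfirst q)
    simp only [σ, Equiv.swap_apply_def]
    split_ifs <;> assumption
  have hσmem : ∀ i, ∀ c ∈ hand i, σ c ∈ hand i := by
    intro i c hc
    simp only [σ, Equiv.swap_apply_def]
    split_ifs with h1 h2
    · rw [howner hc (h1 ▸ ha)]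
      exact hfirst q
    · rw [howner hc (h2 ▸ hfirst q)]
      exact ha
    · exact hc
  have hhand : (fun i => (hand i).image σ) = hand := by
    funext i
    exact Finset.eq_of_subset_of_card_le (Finset.image_subset_iff.2 (hσmem i))
      (Finset.card_image_of_injective _ σ.injective).ge
  have hupdate : σ ∘ play = Function.update play q a := by
    funext i
    by_cases hi : i = q
    · subst hi
      simp [σ]
    · rw [Function.update_of_ne hi]
      exact Equiv.swap_apply_of_ne_of_ne (fun h => hi (howner (h ▸ hfirst i) ha))
        fun h => hi (howner (h ▸ hfirst i) (hfirst q))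
  obtain ⟨L', fin', hL', hrel⟩ := hplays.exists_relabel hsuit hvalid.1 σ hσsuit o.2
  rw [hhand] at hL'
  have hpartner : ∀ t ∈ (⟨o.2, play, w⟩ :: rest : List (Trick p)),
      ∃ t' ∈ L', t'.play = σ ∘ t.play := by
    intro t ht
    obtain ⟨n, hn, rfl⟩ := List.getElem_of_mem ht
    have hn' : n < L'.length := hrel.length_eq ▸ hn
    exact ⟨L'[n], List.getElem_mem hn', hrel.get hn hn'⟩
  have hsucc' : Successful O L' := by
    intro o' ho'
    obtain ⟨t, ht, ⟨j, hj⟩, hwin⟩ := hsucc o' ho'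
    obtain ⟨t', ht', hplay⟩ := hpartner t ht
    obtain ⟨hmem', hwins'⟩ := hL'.play_mem_and_wins t' ht'
    obtain ⟨htmem, htwins⟩ := hmem t ht
    have hjo : j = o'.2 := howner (hj ▸ htmem j) (howned o' ho')
    subst hjo
    have hfix : t'.play o'.2 = o'.1 := by
      rw [hplay, Function.comp_apply, hj]
      exact Equiv.swap_apply_of_ne_of_ne (haobj o' ho') (hbobj o' ho')
    refine ⟨t', ht', ⟨o'.2, hfix⟩, hwins'.unique ⟨?_, fun i hi _ => ?_⟩⟩
    · rw [hsuit _ _ (hmem' _), hsuit _ _ (hmem' _)]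
    · have hlt : (t.play i).1 < o'.1.1 := by
        rw [← hj, ← hwin]
        exact htwins.2 i (hwin ▸ hi) (by rw [hsuit _ _ (htmem _), hsuit _ _ (htmem _)])
      rw [hfix, hplay, Function.comp_apply]
      simp only [σ, Equiv.swap_apply_def]
      split_ifs with h1 h2
      · exact hba.trans (h1 ▸ hlt)
      · rcases List.mem_cons.1 ht with rfl | ht
        · rw [← hj, ← hwin]
          simpa [hw, hleadcard] using hac
        · exact absurd h2 (hrest t ht i q)
      · exact hlt
  cases hrel with
  | @cons _ t' _ rest' ht' _ =>
    obtain ⟨l, pl, w'⟩ := t'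
    obtain rfl : pl = Function.update play q a := ht'.trans hupdate
    cases hL' with
    | cons h1 h2 h3 => exact ⟨w', rest', fin', .cons h1 h2 h3, hsucc'⟩
end

section
/- Consider a Crew instance in which all cards have the same suit (s = 1) and the card of every objective lies in the hand of the player assigned that objective, and fix any enumeration o_1, …, o_l of the objectives O. Define the greedy procedure: for t = 1, …, l in order, play a trick led by the player assigned o_t, who leads the card of o_t, and in which every other player plays the highest-valued card currently in their hand that is not the card of any objective and has value less than the value of the card of o_t, the procedure failing if some player has no such card. Then the instance admits a successful play sequence if and only if the greedy procedure completes all l tricks; in particular, whether the greedy procedure succeeds does not depend on the chosen enumeration of O. -/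
/-- The set of objective cards. -/
def objCards {p : ℕ} (O : Finset (Card × Fin p)) : Finset Card :=
  O.image Prod.fst

/-- The greedy choice for a non-leading player with hand `h`: the highest-valued
card in `h` that is not an objective card and has value below `bound`
(all cards have suit 1 in the single-suit setting). -/
def pickCard (h : Finset Card) (bound : ℕ) (oc : Finset Card) : Card :=
  ((h.filter (fun c => c.1 < bound ∧ c ∉ oc)).sup Prod.fst, 1)

/-- The plays of one greedy trick for objective `o`: the owner of `o` leads the
card of `o`, and every other player plays their greedy choice. -/
def greedyPlay {p : ℕ} (oc : Finset Card) (st : Fin p → Finset Card)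
    (o : Card × Fin p) : Fin p → Card :=
  fun q => if q = o.2 then o.1 else pickCard (st q) o.1.1 oc

/-- The greedy procedure succeeds on the enumeration `os` of the objectives:
for each objective in turn, its owner leads its card, every other player has
(and plays) a non-objective card of smaller value, highest first. -/
def GreedyOk {p : ℕ} (oc : Finset Card) :
    (Fin p → Finset Card) → List (Card × Fin p) → Prop
  | _, [] => True
  | st, o :: os =>
      o.1 ∈ st o.2 ∧
      (∀ q, q ≠ o.2 → ((st q).filter (fun c => c.1 < o.1.1 ∧ c ∉ oc)).Nonempty) ∧
      GreedyOk oc (nextState st (greedyPlay oc st o)) os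

/-- If some card of `h` is a legal greedy choice, then `pickCard` returns such a card, and one of
maximal value. -/
theorem pickCard_spec {h : Finset Card} {bound : ℕ} {oc : Finset Card}
    (hsuit : ∀ c ∈ h, c.2 = 1)
    (hne : (h.filter (fun c => c.1 < bound ∧ c ∉ oc)).Nonempty) :
    pickCard h bound oc ∈ h ∧ (pickCard h bound oc).1 < bound ∧ pickCard h bound oc ∉ oc ∧
      ∀ c ∈ h, c.1 < bound → c ∉ oc → c.1 ≤ (pickCard h bound oc).1 := by
  obtain ⟨c, hc, hmax⟩ := Finset.exists_mem_eq_sup _ hne Prod.fst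
  obtain ⟨hch, hcb, hco⟩ := Finset.mem_filter.1 hc
  have hpick : pickCard h bound oc = c := Prod.ext hmax (hsuit c hch).symm
  rw [hpick]
  refine ⟨hch, hcb, hco, fun d hd hdb hdo => ?_⟩
  rw [← hmax]
  exact Finset.le_sup (f := Prod.fst) (Finset.mem_filter.2 ⟨hd, hdb, hdo⟩)

/-- Every player can assign distinct smaller non-objective cards of their hand to the objectives
in `os` of the other players. -/
def Matchable {p : ℕ} (oc : Finset Card) (st : Fin p → Finset Card)
    (os : List (Card × Fin p)) : Prop :=
  ∀ q, ∃ f : Card × Fin p → Card,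
    (∀ o ∈ os, o.2 ≠ q → f o ∈ st q ∧ (f o).1 < o.1.1 ∧ f o ∉ oc) ∧
    ∀ o ∈ os, ∀ o' ∈ os, o.2 ≠ q → o'.2 ≠ q → f o = f o' → o = o'

/-- A greedy trick preserves the existence of assignments, by an exchange argument. -/
theorem Matchable.nextState_greedyPlay {p : ℕ} {oc : Finset Card} {st : Fin p → Finset Card}
    {o : Card × Fin p} {os : List (Card × Fin p)} (hm : Matchable oc st (o :: os))
    (hsuit : ∀ i, ∀ c ∈ st i, c.2 = 1) (ho : o.1 ∈ oc) (hnot : o ∉ os) :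
    Matchable oc (nextState st (greedyPlay oc st o)) os := by
  intro q
  obtain ⟨f, hf, hinj⟩ := hm q
  by_cases hq : o.2 = q
  · refine ⟨f, fun x hx hxq => ?_, fun x hx y hy =>
      hinj x (List.mem_cons_of_mem _ hx) y (List.mem_cons_of_mem _ hy)⟩
    obtain ⟨h1, h2, h3⟩ := hf x (List.mem_cons_of_mem _ hx) hxq
    refine ⟨?_, h2, h3⟩
    simp only [nextState, greedyPlay, hq, if_true, Finset.mem_erase]
    exact ⟨fun h => h3 (h ▸ ho), h1⟩
  · obtain ⟨h1, h2, h3⟩ := hf o List.mem_cons_self hq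
    obtain ⟨-, -, -, hmax⟩ := pickCard_spec (bound := o.1.1) (oc := oc) (hsuit q)
      ⟨f o, Finset.mem_filter.2 ⟨h1, h2, h3⟩⟩
    have hle := hmax (f o) h1 h2 h3
    have hst : nextState st (greedyPlay oc st o) q = (st q).erase (pickCard (st q) o.1.1 oc) := by
      simp [nextState, greedyPlay, Ne.symm hq]
    rw [hst]
    generalize pickCard (st q) o.1.1 oc = g at *
    refine ⟨fun x => if f x = g then f o else f x, fun x hx hxq => ?_,
      fun x hx y hy hxq hyq hxy => ?_⟩
    · obtain ⟨k1, k2, k3⟩ := hf x (List.mem_cons_of_mem _ hx) hxq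
      have hne : f o ≠ f x := fun h =>
        hnot (hinj o List.mem_cons_self x (List.mem_cons_of_mem _ hx) hq hxq h ▸ hx)
      by_cases hg : f x = g
      · simp only [hg, if_true, Finset.mem_erase]
        rw [hg] at k2 hne
        exact ⟨⟨hne, h1⟩, hle.trans_lt k2, h3⟩
      · simp only [hg, if_false, Finset.mem_erase]
        exact ⟨⟨hg, k1⟩, k2, k3⟩
    · have hx' := List.mem_cons_of_mem o hx
      have hy' := List.mem_cons_of_mem o hy
      have hxo : f o ≠ f x := fun h => hnot (hinj o List.mem_cons_self x hx' hq hxq h ▸ hx)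
      have hyo : f o ≠ f y := fun h => hnot (hinj o List.mem_cons_self y hy' hq hyq h ▸ hy)
      apply hinj x hx' y hy' hxq hyq
      grind

theorem Matchable.greedyOk {p : ℕ} {oc : Finset Card} {os : List (Card × Fin p)}
    {st : Fin p → Finset Card} (hm : Matchable oc st os)
    (hsuit : ∀ i, ∀ c ∈ st i, c.2 = 1) (hoc : ∀ o ∈ os, o.1 ∈ oc)
    (howned : ∀ o ∈ os, o.1 ∈ st o.2) (hnodup : (os.map Prod.fst).Nodup) :
    GreedyOk oc st os := by
  induction os generalizing st with
  | nil => trivial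
  | cons o os ih =>
    have hne : ∀ q, q ≠ o.2 → ((st q).filter (fun c => c.1 < o.1.1 ∧ c ∉ oc)).Nonempty := by
      intro q hq
      obtain ⟨f, hf, -⟩ := hm q
      exact ⟨f o, Finset.mem_filter.2 (hf o List.mem_cons_self hq.symm)⟩
    rw [List.map_cons, List.nodup_cons] at hnodup
    have hoo := hoc o List.mem_cons_self
    refine ⟨howned o List.mem_cons_self, hne, ih ?_ ?_ ?_ ?_ hnodup.2⟩
    · exact hm.nextState_greedyPlay hsuit hoo fun h => hnodup.1 (List.mem_map_of_mem h)
    · exact fun i c hc => hsuit i c (Finset.mem_of_mem_erase hc)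
    · exact fun x hx => hoc x (List.mem_cons_of_mem _ hx)
    · intro x hx
      refine Finset.mem_erase.2 ⟨?_, howned x (List.mem_cons_of_mem _ hx)⟩
      by_cases hxo : x.2 = o.2
      · simp only [greedyPlay, hxo, if_true]
        exact fun h => hnodup.1 (h ▸ List.mem_map_of_mem hx)
      · simp only [greedyPlay, hxo, if_false]
        exact fun h => (pickCard_spec (hsuit x.2) (hne x.2 hxo)).2.2.1
          (h ▸ hoc x (List.mem_cons_of_mem _ hx))

theorem GreedyOk.exists_playsFrom {p : ℕ} {oc : Finset Card} {os : List (Card × Fin p)}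
    {st : Fin p → Finset Card} (hg : GreedyOk oc st os)
    (hsuit : ∀ i, ∀ c ∈ st i, c.2 = 1) (lead : Fin p) :
    ∃ L fin, PlaysFrom st lead L fin ∧ ∀ o ∈ os, ∃ t ∈ L, Completes t o := by
  induction os generalizing st lead with
  | nil => exact ⟨[], st, .nil st lead, by simp⟩
  | cons o os ih =>
    obtain ⟨hmem, hne, hrest⟩ := hg
    obtain ⟨L, fin, hL, hcomp⟩ := ih hrest
      (fun i c hc => hsuit i c (Finset.mem_of_mem_erase hc)) o.2
    have hown : greedyPlay oc st o o.2 = o.1 := by simp [greedyPlay]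
    have hother : ∀ i, i ≠ o.2 → greedyPlay oc st o i = pickCard (st i) o.1.1 oc :=
      fun i hi => by simp [greedyPlay, hi]
    have hplay : ∀ i, greedyPlay oc st o i ∈ st i := by
      intro i
      by_cases hi : i = o.2
      · rw [hi, hown]; exact hmem
      · rw [hother i hi]; exact (pickCard_spec (hsuit i) (hne i hi)).1
    have hs : ∀ i j, (greedyPlay oc st o i).2 = (greedyPlay oc st o j).2 := fun i j =>
      (hsuit i _ (hplay i)).trans (hsuit j _ (hplay j)).symm
    refine ⟨⟨lead, greedyPlay oc st o, o.2⟩ :: L, fin,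
      .cons ⟨fun i => ⟨_, hplay i⟩, hplay, fun i => .inl (hs i lead)⟩
        ⟨hs _ _, fun j hj _ => ?_⟩ hL, fun x hx => ?_⟩
    · rw [hown, hother j hj]
      exact (pickCard_spec (hsuit j) (hne j hj)).2.1
    · rcases List.mem_cons.1 hx with rfl | hx
      · exact ⟨_, List.mem_cons_self, ⟨x.2, hown⟩, rfl⟩
      · obtain ⟨t, ht, hc⟩ := hcomp x hx
        exact ⟨t, List.mem_cons_of_mem _ ht, hc⟩

namespace PlaysFrom

variable {p : ℕ} {st fin : Fin p → Finset Card} {lead : Fin p} {L : List (Trick p)}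

theorem play_mem_s6 (h : PlaysFrom st lead L fin) : ∀ t ∈ L, ∀ i, t.play i ∈ st i := by
  induction h with
  | nil => simp
  | cons hok _ _ ih =>
    intro t ht i
    rcases List.mem_cons.1 ht with rfl | ht
    · exact hok.2.1 i
    · exact Finset.mem_of_mem_erase (ih t ht i)

theorem wins (h : PlaysFrom st lead L fin) : ∀ t ∈ L, Wins t.lead t.play t.winner := by
  induction h with
  | nil => simp
  | cons _ hw _ ih =>
    intro t ht
    rcases List.mem_cons.1 ht with rfl | ht
    · exact hw
    · exact ih t ht

/-- A card is played by its holder in at most one trick. -/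
theorem eq_of_play_eq (h : PlaysFrom st lead L fin) :
    ∀ t ∈ L, ∀ t' ∈ L, ∀ i, t.play i = t'.play i → t = t' := by
  induction h with
  | nil => simp
  | cons _ _ hr ih =>
    intro t ht t' ht' i hi
    rcases List.mem_cons.1 ht with rfl | ht <;> rcases List.mem_cons.1 ht' with rfl | ht'
    · rfl
    · exact absurd hi.symm (Finset.ne_of_mem_erase (hr.play_mem_s6 t' ht' i))
    · exact absurd hi (Finset.ne_of_mem_erase (hr.play_mem_s6 t ht i))
    · exact ih t ht t' ht' i hi

end PlaysFrom

/-- In a successful play sequence, the cards a player plays in the tricks completing the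
objectives of the other players form an assignment. -/
theorem HasSuccess.matchable {p : ℕ} {hand : Fin p → Finset Card} {O : Finset (Card × Fin p)}
    (h : HasSuccess hand O) (hvalid : ValidInstance hand O)
    (hsuit : ∀ i, ∀ c ∈ hand i, c.2 = 1) (howned : ∀ o ∈ O, o.1 ∈ hand o.2)
    {os : List (Card × Fin p)} (henum : ∀ o, o ∈ os ↔ o ∈ O) :
    Matchable (objCards O) hand os := by
  obtain ⟨lead, L, fin, hL, hsucc⟩ := h
  have holder : ∀ c i j, c ∈ hand i → c ∈ hand j → i = j := fun c i j hi hj =>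
    by_contra fun hij => Finset.disjoint_left.1 (hvalid.1 i j hij) hi hj
  have : Nonempty (Trick p) := ⟨⟨lead, fun _ => 0, lead⟩⟩
  choose! T hT hcomp using hsucc
  have hplay : ∀ o ∈ O, (T o).play o.2 = o.1 := by
    intro o ho
    obtain ⟨⟨j, hj⟩, -⟩ := hcomp o ho
    rwa [holder o.1 j o.2 (hj ▸ hL.play_mem_s6 _ (hT o ho) j) (howned o ho)] at hj
  intro q
  refine ⟨fun o => (T o).play q, fun o ho hoq => ?_, fun o ho o' ho' _ _ heq => ?_⟩
  · rw [henum] at ho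
    have hwin := (hcomp o ho).2
    have hmem := hL.play_mem_s6 _ (hT o ho)
    refine ⟨hmem q, ?_, fun hobj => ?_⟩
    · have hlt := (hL.wins _ (hT o ho)).2 q (by rw [hwin]; exact hoq.symm)
        ((hsuit q _ (hmem q)).trans (hsuit _ _ (hmem _)).symm)
      rwa [hwin, hplay o ho] at hlt
    · obtain ⟨o', ho', heq⟩ := Finset.mem_image.1 hobj
      have hq : o'.2 = q := holder o'.1 o'.2 q (howned o' ho') (heq ▸ hmem q)
      have hTT : T o' = T o :=
        hL.eq_of_play_eq _ (hT o' ho') _ (hT o ho) q (by rw [← hq, hplay o' ho', heq, hq])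
      exact hoq (by rw [← hwin, ← hTT, (hcomp o' ho').2, hq])
  · rw [henum] at ho ho'
    have hTT : T o = T o' := hL.eq_of_play_eq _ (hT o ho) _ (hT o' ho') q heq
    have hown : o.2 = o'.2 := by rw [← (hcomp o ho).2, ← (hcomp o' ho').2, hTT]
    exact hvalid.2.2 o ho o' ho' (by rw [← hplay o ho, ← hplay o' ho', hTT, hown])

/-- Single-suit, owned objectives. For any enumeration of the
objectives, the instance admits a successful play sequence iff the greedy
procedure completes all its tricks; in particular the outcome of the greedy
procedure does not depend on the enumeration. -/
theorem crew_owned_single_suit_greedy {p : ℕ} (hp : 2 ≤ p)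
    (hand : Fin p → Finset Card) (O : Finset (Card × Fin p))
    (hvalid : ValidInstance hand O)
    (hsuit : ∀ i : Fin p, ∀ c ∈ hand i, c.2 = 1)
    (howned : ∀ o ∈ O, o.1 ∈ hand o.2)
    (os : List (Card × Fin p)) (hnodup : os.Nodup)
    (henum : ∀ o, o ∈ os ↔ o ∈ O) :
    (HasSuccess hand O ↔ GreedyOk (objCards O) hand os) ∧
      (∀ os' : List (Card × Fin p), os'.Nodup → (∀ o, o ∈ os' ↔ o ∈ O) →
        (GreedyOk (objCards O) hand os ↔ GreedyOk (objCards O) hand os')) := by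
  have key : ∀ os : List (Card × Fin p), os.Nodup → (∀ o, o ∈ os ↔ o ∈ O) →
      (HasSuccess hand O ↔ GreedyOk (objCards O) hand os) := by
    intro os hnodup henum
    constructor
    · intro h
      refine (h.matchable hvalid hsuit howned henum).greedyOk hsuit
        (fun o ho => Finset.mem_image_of_mem _ ((henum o).1 ho))
        (fun o ho => howned o ((henum o).1 ho)) ?_
      exact hnodup.map_on fun x hx y hy hxy =>
        hvalid.2.2 x ((henum x).1 hx) y ((henum y).1 hy) hxy
    · intro h
      obtain ⟨L, fin, hL, hc⟩ := h.exists_playsFrom hsuit ⟨0, by omega⟩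
      exact ⟨_, L, fin, hL, fun o ho => hc o ((henum o).2 ho)⟩
  exact ⟨key os hnodup henum, fun os' hnodup' henum' =>
    (key os hnodup henum).symm.trans (key os' hnodup' henum')⟩
end

section
/- In any Crew instance in which all cards have the same suit (s = 1), suppose σ is a successful play sequence containing a trick t immediately followed by a trick t', both won by the same player i, such that player i plays no objective card in t or t', and no other single player plays objective cards in both t and t'. Then there is a successful play sequence with one fewer trick, completing the same set of objectives, obtained by replacing t and t' with a single trick in which each player plays the objective card they played in t or t' if they played one, and otherwise plays the higher-valued of the two cards they played in t and t', with all other tricks of σ unchanged. -/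
/-- Every card held by any player has suit `1`. -/
def SingleSuit {p : ℕ} (st : Fin p → Finset Card) : Prop :=
  ∀ i, ∀ c ∈ st i, c.2 = 1

theorem SingleSuit.nextState {p : ℕ} {st : Fin p → Finset Card} (h : SingleSuit st)
    (play : Fin p → Card) : SingleSuit (nextState st play) :=
  fun i c hc => h i c (Finset.mem_of_mem_erase hc)

theorem SingleSuit.trickOk {p : ℕ} {st : Fin p → Finset Card} (h : SingleSuit st)
    (lead : Fin p) {play : Fin p → Card} (hplay : ∀ i, play i ∈ st i) :
    TrickOk st lead play :=
  ⟨fun i => ⟨_, hplay i⟩, hplay, fun i =>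
    Or.inl ((h i _ (hplay i)).trans (h lead _ (hplay lead)).symm)⟩

/-- With a single suit, a play sequence stays legal when hands are enlarged. -/
theorem PlaysFrom.exists_of_subset {p : ℕ} {st st' : Fin p → Finset Card} {lead : Fin p}
    {L : List (Trick p)} {fin : Fin p → Finset Card} (h : PlaysFrom st lead L fin)
    (hsub : ∀ i, st i ⊆ st' i) (hs : SingleSuit st') : ∃ fin', PlaysFrom st' lead L fin' := by
  induction h generalizing st' with
  | nil st lead => exact ⟨st', .nil st' lead⟩
  | @cons st lead play w rest fin hok hw _ ih =>
    obtain ⟨fin', h'⟩ := ih (st' := _root_.nextState st' play)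
      (fun i => Finset.erase_subset_erase _ (hsub i)) (hs.nextState play)
    exact ⟨fin', .cons (hs.trickOk lead fun i => hsub i (hok.2.1 i)) hw h'⟩

/-- A tail of a single-suit play sequence can be replaced by one that is
playable from every position from which the original tail is. -/
theorem PlaysFrom.exists_append_of_forall {p : ℕ} {st : Fin p → Finset Card} {lead : Fin p}
    {L M M' : List (Trick p)} {fin : Fin p → Finset Card}
    (h : PlaysFrom st lead (L ++ M) fin) (hs : SingleSuit st)
    (hM : ∀ st lead fin, SingleSuit st → PlaysFrom st lead M fin →
      ∃ fin', PlaysFrom st lead M' fin') :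
    ∃ fin', PlaysFrom st lead (L ++ M') fin' := by
  induction L generalizing st lead with
  | nil => exact hM st lead fin hs h
  | cons t L ih =>
    rw [List.cons_append] at h
    cases h with
    | @cons _ _ play w _ _ hok hw hrest =>
      obtain ⟨fin', h'⟩ := ih hrest (hs.nextState play)
      exact ⟨fin', .cons hok hw h'⟩

/-- The card each player plays in the merge of two tricks: their card in `S` if
there is one, and otherwise the higher of their two cards. -/
abbrev mergePlay {p : ℕ} (S : Finset Card) (pt pt' : Fin p → Card) : Fin p → Card := fun q =>
  if pt q ∈ S then pt q
  else if pt' q ∈ S then pt' q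
  else if (pt' q).1 ≤ (pt q).1 then pt q else pt' q

theorem mergePlay_eq_or {p : ℕ} (S : Finset Card) (pt pt' : Fin p → Card) (q : Fin p) :
    mergePlay S pt pt' q = pt q ∨ mergePlay S pt pt' q = pt' q := by
  grind

theorem wins_mergePlay {p : ℕ} {S : Finset Card} {pt pt' : Fin p → Card} {lt lt' i : Fin p}
    (hpt : ∀ q, (pt q).2 = 1) (hpt' : ∀ q, (pt' q).2 = 1)
    (hw : Wins lt pt i) (hw' : Wins lt' pt' i) (hi : pt i ∉ S) (hi' : pt' i ∉ S) :
    Wins lt (mergePlay S pt pt') i := by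
  have hsuit : ∀ q, (mergePlay S pt pt' q).2 = 1 := fun q => by
    rcases mergePlay_eq_or S pt pt' q with h | h <;> rw [h]
    exacts [hpt q, hpt' q]
  have hmax : (pt i).1 ≤ (mergePlay S pt pt' i).1 ∧ (pt' i).1 ≤ (mergePlay S pt pt' i).1 := by
    grind
  refine ⟨(hsuit i).trans (hsuit lt).symm, fun j hj _ => ?_⟩
  rcases mergePlay_eq_or S pt pt' j with h | h <;> rw [h]
  · exact (hw.2 j hj ((hpt j).trans (hpt lt).symm)).trans_le hmax.1
  · exact (hw'.2 j hj ((hpt' j).trans (hpt' lt').symm)).trans_le hmax.2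

/-- With a single suit, two consecutive tricks won by a player who plays no card
of `S` in either can be merged in a play sequence. -/
theorem PlaysFrom.exists_merge {p : ℕ} {S : Finset Card} {st : Fin p → Finset Card}
    {lead lt lt' i : Fin p} {pt pt' : Fin p → Card} {L : List (Trick p)}
    {fin : Fin p → Finset Card} (hs : SingleSuit st)
    (h : PlaysFrom st lead (⟨lt, pt, i⟩ :: ⟨lt', pt', i⟩ :: L) fin)
    (hi : pt i ∉ S) (hi' : pt' i ∉ S) :
    ∃ fin', PlaysFrom st lead (⟨lt, mergePlay S pt pt', i⟩ :: L) fin' := by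
  cases h with
  | cons hok hw h =>
  cases h with
  | cons hok' hw' h =>
  have hmem : ∀ q, pt q ∈ st q := hok.2.1
  have hmem' : ∀ q, pt' q ∈ st q := fun q => Finset.mem_of_mem_erase (hok'.2.1 q)
  have hplay : ∀ q, mergePlay S pt pt' q ∈ st q := fun q => by
    rcases mergePlay_eq_or S pt pt' q with h | h <;> rw [h]
    exacts [hmem q, hmem' q]
  have hsub : ∀ q, _root_.nextState (_root_.nextState st pt) pt' q ⊆
      _root_.nextState st (mergePlay S pt pt') q := fun q c hc => by
    simp only [_root_.nextState, Finset.mem_erase] at hc ⊢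
    rcases mergePlay_eq_or S pt pt' q with h | h <;> rw [h]
    exacts [hc.2, ⟨hc.1, hc.2.2⟩]
  obtain ⟨fin', h'⟩ := h.exists_of_subset hsub (hs.nextState _)
  exact ⟨fin', .cons (hs.trickOk _ hplay)
    (wins_mergePlay (fun q => hs q _ (hmem q)) (fun q => hs q _ (hmem' q)) hw hw' hi hi') h'⟩

/-- The merged trick completes every objective that the two tricks complete. -/
theorem Completes.mergePlay {p : ℕ} {O : Finset (Card × Fin p)} {lt lt' i : Fin p}
    {pt pt' : Fin p → Card} {o : Card × Fin p} (ho : o ∈ O)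
    (hnot : ∀ q, ¬(pt q ∈ objCards O ∧ pt' q ∈ objCards O))
    (h : Completes ⟨lt, pt, i⟩ o ∨ Completes ⟨lt', pt', i⟩ o) :
    Completes ⟨lt, mergePlay (objCards O) pt pt', i⟩ o := by
  have hobj : o.1 ∈ objCards O := Finset.mem_image_of_mem _ ho
  rcases h with ⟨⟨j, hj⟩, hw⟩ | ⟨⟨j, hj⟩, hw⟩ <;>
  · refine ⟨⟨j, ?_⟩, hw⟩
    grind

/-- Single suit. If a successful play sequence contains two
consecutive tricks won by the same player i, where i plays no objective card in
either trick and no other single player plays objective cards in both tricks,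
then merging the two tricks into one (each player playing the objective card
they played if any, and otherwise the higher of their two cards) again gives a
successful play sequence, one trick shorter, with all other tricks unchanged. -/
theorem crew_single_suit_merge_tricks {p : ℕ} (hp : 2 ≤ p)
    (hand : Fin p → Finset Card) (O : Finset (Card × Fin p))
    (hvalid : ValidInstance hand O)
    (hsuit : ∀ i : Fin p, ∀ c ∈ hand i, c.2 = 1)
    (lead0 : Fin p) (L1 L2 : List (Trick p)) (i lt lt' : Fin p)
    (pt pt' : Fin p → Card) (fin : Fin p → Finset Card)
    (hplays : PlaysFrom hand lead0 (L1 ++ ⟨lt, pt, i⟩ :: ⟨lt', pt', i⟩ :: L2) fin)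
    (hsucc : Successful O (L1 ++ ⟨lt, pt, i⟩ :: ⟨lt', pt', i⟩ :: L2))
    (hinoobj : pt i ∉ objCards O ∧ pt' i ∉ objCards O)
    (hother : ∀ q, q ≠ i → ¬(pt q ∈ objCards O ∧ pt' q ∈ objCards O)) :
    ∃ (w : Fin p) (fin' : Fin p → Finset Card),
      PlaysFrom hand lead0
        (L1 ++
          ⟨lt, fun q =>
            if pt q ∈ objCards O then pt q
            else if pt' q ∈ objCards O then pt' q
            else if (pt' q).1 ≤ (pt q).1 then pt q else pt' q, w⟩ :: L2) fin' ∧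
      Successful O
        (L1 ++
          ⟨lt, fun q =>
            if pt q ∈ objCards O then pt q
            else if pt' q ∈ objCards O then pt' q
            else if (pt' q).1 ≤ (pt q).1 then pt q else pt' q, w⟩ :: L2) := by
  refine ⟨i, ?_⟩
  obtain ⟨fin', h⟩ := hplays.exists_append_of_forall hsuit fun st lead fin hs h =>
    h.exists_merge hs hinoobj.1 hinoobj.2
  refine ⟨fin', h, fun o ho => ?_⟩
  have hnot : ∀ q, ¬(pt q ∈ objCards O ∧ pt' q ∈ objCards O) := fun q hq => by
    by_cases hqi : q = i
    · exact hinoobj.1 (hqi ▸ hq.1)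
    · exact hother q hqi hq
  obtain ⟨t, ht, hc⟩ := hsucc o ho
  rcases List.mem_append.1 ht with ht | ht
  · exact ⟨t, List.mem_append_left _ ht, hc⟩
  rcases List.mem_cons.1 ht with rfl | ht
  · exact ⟨_, List.mem_append_right _ List.mem_cons_self,
      Completes.mergePlay (lt' := lt') ho hnot (.inl hc)⟩
  rcases List.mem_cons.1 ht with rfl | ht
  · exact ⟨_, List.mem_append_right _ List.mem_cons_self,
      Completes.mergePlay ho hnot (.inr hc)⟩
  · exact ⟨t, List.mem_append_right _ (List.mem_cons_of_mem _ ht), hc⟩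
end

section
/- In any Crew instance in which all cards have the same suit (s = 1), if a successful play sequence exists, then there is a successful play sequence in which the objectives are completed in non-increasing order of the values of their cards; more precisely, for any two tricks of the sequence each of which completes at least one objective, the maximum value among the objective cards collected in the earlier trick is greater than the maximum value among the objective cards collected in the later trick. -/
/-- The tricks of a play sequence with cards of a single suit use cards of the initial hands,
are won by the highest value, and no player repeats a card. -/
theorem PlaysFrom.tricks_of_single_suit {p : ℕ} {st fin : Fin p → Finset Card} {lead : Fin p}
    {L : List (Trick p)} (h : PlaysFrom st lead L fin) (hsuit : ∀ i, ∀ c ∈ st i, c.2 = 1) :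
    (∀ t ∈ L, (∀ i, t.play i ∈ st i) ∧
      ∀ j, j ≠ t.winner → (t.play j).1 < (t.play t.winner).1) ∧
    L.Pairwise (fun s t => ∀ i, s.play i ≠ t.play i) := by
  induction h with
  | nil => simp
  | @cons st lead play w rest fin hok hwin _ ih =>
    obtain ⟨hmem, hpair⟩ := ih fun i c hc => hsuit i c (Finset.mem_of_mem_erase hc)
    refine ⟨?_, List.pairwise_cons.2 ⟨fun t ht i => ?_, hpair⟩⟩
    · rintro t (_ | ⟨_, ht⟩)
      · refine ⟨hok.2.1, fun j hj => hwin.2 j hj ?_⟩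
        rw [hsuit _ _ (hok.2.1 j), hsuit _ _ (hok.2.1 lead)]
      · exact ⟨fun i => Finset.mem_of_mem_erase ((hmem t ht).1 i), (hmem t ht).2⟩
    · exact (Finset.ne_of_mem_erase ((hmem t ht).1 i)).symm

/-- With cards of a single suit, any list of card choices from the hands in which no player
repeats a card is the list of tricks of some play sequence, whoever leads first. -/
theorem exists_playsFrom_of_single_suit {p : ℕ} (K : List ((Fin p → Card) × Fin p))
    (st : Fin p → Finset Card) (lead : Fin p) (hsuit : ∀ i, ∀ c ∈ st i, c.2 = 1)
    (hmem : ∀ k ∈ K, (∀ i, k.1 i ∈ st i) ∧ ∀ j, j ≠ k.2 → (k.1 j).1 < (k.1 k.2).1)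
    (hpair : K.Pairwise (fun k l => ∀ i, k.1 i ≠ l.1 i)) :
    ∃ L fin, PlaysFrom st lead L fin ∧ L.map (fun t => (t.play, t.winner)) = K := by
  induction K generalizing st lead with
  | nil => exact ⟨[], st, .nil st lead, rfl⟩
  | cons k K ih =>
    obtain ⟨hk, hpair⟩ := List.pairwise_cons.1 hpair
    obtain ⟨hplay, hwin⟩ := hmem k (by simp)
    have hs : ∀ i, (k.1 i).2 = 1 := fun i => hsuit i _ (hplay i)
    obtain ⟨L, fin, hL, hmap⟩ := ih (nextState st k.1) k.2
      (fun i c hc => hsuit i c (Finset.mem_of_mem_erase hc))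
      (fun l hl => ⟨fun i => Finset.mem_erase.2
        ⟨(hk l hl i).symm, (hmem l (List.mem_cons_of_mem _ hl)).1 i⟩,
        (hmem l (List.mem_cons_of_mem _ hl)).2⟩) hpair
    refine ⟨⟨lead, k.1, k.2⟩ :: L, fin, .cons ⟨fun i => ⟨_, hplay i⟩, hplay, fun i => ?_⟩
      ⟨?_, fun j hj _ => hwin j hj⟩ hL, by simp [hmap]⟩
    · simp [hs]
    · simp [hs]

/-- Single suit. If a successful play sequence exists, then one
exists in which the objectives are completed in strictly decreasing order of
the maximum value of the objective cards collected per objective-completing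
trick. -/
theorem crew_single_suit_descending_order {p : ℕ} (hp : 2 ≤ p)
    (hand : Fin p → Finset Card) (O : Finset (Card × Fin p))
    (hvalid : ValidInstance hand O)
    (hsuit : ∀ i : Fin p, ∀ c ∈ hand i, c.2 = 1) :
    HasSuccess hand O →
      ∃ lead L fin, PlaysFrom hand lead L fin ∧ Successful O L ∧
        ∀ (a b : ℕ) (ha : a < L.length) (hb : b < L.length), a < b →
          (∃ o ∈ O, Completes (L.get ⟨a, ha⟩) o) →
          (∃ o ∈ O, Completes (L.get ⟨b, hb⟩) o) →
          (O.filter (fun o => Completes (L.get ⟨b, hb⟩) o)).sup (fun o => o.1.1) <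
            (O.filter (fun o => Completes (L.get ⟨a, ha⟩) o)).sup (fun o => o.1.1) := by
  rintro ⟨lead, L₀, fin₀, hL₀, hsucc⟩
  obtain ⟨hmem₀, hpair₀⟩ := hL₀.tricks_of_single_suit hsuit
  let core : Trick p → (Fin p → Card) × Fin p := fun t => (t.play, t.winner)
  let score : (Fin p → Card) × Fin p → ℕ := fun k =>
    (O.filter (fun o => Completes ⟨lead, k.1, k.2⟩ o)).sup (fun o => o.1.1)
  let K := (L₀.map core).mergeSort (fun k l => decide (score l ≤ score k))
  have hperm : K.Perm (L₀.map core) := List.mergeSort_perm _ _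
  have hsorted : K.Pairwise (fun k l => score l ≤ score k) := by
    have := List.pairwise_mergeSort (le := fun k l => decide (score l ≤ score k))
      (by simp only [decide_eq_true_eq]; intro a b c; omega)
      (by simp only [Bool.or_eq_true, decide_eq_true_eq]; intro a b; omega) (L₀.map core)
    simpa using this
  have hmem : ∀ k ∈ K, (∀ i, k.1 i ∈ hand i) ∧
      ∀ j, j ≠ k.2 → (k.1 j).1 < (k.1 k.2).1 := by
    intro k hk
    obtain ⟨t, ht, rfl⟩ := List.mem_map.1 (hperm.mem_iff.1 hk)
    exact hmem₀ t ht
  have hpair : K.Pairwise (fun k l => ∀ i, k.1 i ≠ l.1 i) :=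
    (hperm.pairwise_iff fun h i => (h i).symm).2 (List.pairwise_map.2 hpair₀)
  obtain ⟨L, fin, hL, hmap⟩ := exists_playsFrom_of_single_suit K hand lead hsuit hmem hpair
  refine ⟨lead, L, fin, hL, fun o ho => ?_, fun a b ha hb hab hao hbo => ?_⟩
  · obtain ⟨t, ht, hto⟩ := hsucc o ho
    have : core t ∈ L.map core := hmap ▸ hperm.mem_iff.2 (List.mem_map_of_mem ht)
    obtain ⟨t', ht', heq⟩ := List.mem_map.1 this
    obtain ⟨hp', hw'⟩ := Prod.mk.inj heq
    exact ⟨t', ht', by rw [Completes, hp', hw']; exact hto⟩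
  rw [← hmap, List.pairwise_map] at hsorted
  have hle := List.pairwise_iff_get.1 hsorted ⟨a, ha⟩ ⟨b, hb⟩ hab
  obtain ⟨hmemL, hpairL⟩ := hL.tricks_of_single_suit hsuit
  have hne := List.pairwise_iff_get.1 hpairL ⟨a, ha⟩ ⟨b, hb⟩ hab
  have hma := (hmemL _ (L.get_mem ⟨a, ha⟩)).1
  have hmb := (hmemL _ (L.get_mem ⟨b, hb⟩)).1
  generalize L.get ⟨a, ha⟩ = s at *
  generalize L.get ⟨b, hb⟩ = t at *
  refine lt_of_le_of_ne hle fun heq => ?_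
  have hsup : ∀ u : Trick p, (∃ o ∈ O, Completes u o) → ∃ j,
      (O.filter (fun o => Completes u o)).sup (fun o => o.1.1) = (u.play j).1 := by
    rintro u ⟨o, ho, huo⟩
    obtain ⟨q, hq, hqs⟩ := Finset.exists_mem_eq_sup (O.filter (fun o => Completes u o))
      ⟨o, Finset.mem_filter.2 ⟨ho, huo⟩⟩ (fun o => o.1.1)
    obtain ⟨j, hj⟩ := (Finset.mem_filter.1 hq).2.1
    exact ⟨j, by rw [hqs, hj]⟩
  obtain ⟨i, hi⟩ := hsup s hao
  obtain ⟨j, hj⟩ := hsup t hbo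
  have hcard : s.play i = t.play j := Prod.ext (by rw [← hi, ← hj, heq])
    (by rw [hsuit _ _ (hma i), hsuit _ _ (hmb j)])
  by_cases hij : i = j
  · subst hij
    exact hne i hcard
  · exact Finset.disjoint_left.1 (hvalid.1 i j hij) (hma i) (hcard ▸ hmb j)
end

section
/- Let G be a finite simple undirected graph on vertex set {1, …, m} with m ≥ 2, and let I(G) be the Crew instance associated to G by the reduction. Then every successful play sequence of I(G) consists of exactly m tricks, and each of its tricks completes exactly one objective. -/
/-- The hand dealt to player `j` by the reduction from a graph `G`: for each
neighbor `i` of `j`, the card `(f i j, suit i)`; the card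
`(deg j + 1, suit j)`; and the junk cards of `j`. -/
def reductionHand {m : ℕ} (G : SimpleGraph (Fin m)) [DecidableRel G.Adj]
    (f : Fin m → Fin m → ℕ) (junk : Fin m → Finset Card) : Fin m → Finset Card :=
  fun j =>
    (G.neighborFinset j).image (fun i => (f i j, (i : ℕ))) ∪
      {((G.degree j + 1 : ℕ), (j : ℕ))} ∪ junk j

/-- The objectives of the reduction: player `j` must win the card
`(deg j + 1, suit j)`. -/
def reductionObjs {m : ℕ} (G : SimpleGraph (Fin m)) [DecidableRel G.Adj] :
    Finset (Card × Fin m) :=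
  Finset.univ.image (fun j => (((G.degree j + 1 : ℕ), (j : ℕ)), j))

/-- Every trick removes a card from each hand, so a play sequence is no longer than any hand. -/
theorem PlaysFrom.length_le_card {p : ℕ} {st fin : Fin p → Finset Card} {lead : Fin p}
    {L : List (Trick p)} (h : PlaysFrom st lead L fin) (i : Fin p) :
    L.length ≤ (st i).card := by
  induction h with
  | nil => simp
  | cons hok _ _ ih =>
    rw [nextState, Finset.card_erase_of_mem (hok.2.1 i)] at ih
    have := (hok.1 i).card_pos
    simp only [List.length_cons]
    omega

theorem card_reductionHand_le {m : ℕ} (G : SimpleGraph (Fin m)) [DecidableRel G.Adj]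
    (f : Fin m → Fin m → ℕ) (junk : Fin m → Finset Card) (i : Fin m)
    (hjunk : (junk i).card = m - G.degree i - 1) :
    (reductionHand G f junk i).card ≤ m := by
  have hdeg : G.degree i < m := by simpa using G.degree_lt_card_verts i
  have himage : ((G.neighborFinset i).image (fun k => (f k i, (k : ℕ)))).card ≤ G.degree i :=
    Finset.card_image_le
  have hunion := Finset.card_union_le
    ((G.neighborFinset i).image (fun k => (f k i, (k : ℕ))) ∪
      {((G.degree i + 1 : ℕ), (i : ℕ))}) (junk i)
  have hunion' := Finset.card_union_le
    ((G.neighborFinset i).image (fun k => (f k i, (k : ℕ)))) {((G.degree i + 1 : ℕ), (i : ℕ))}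
  rw [Finset.card_singleton] at hunion'
  unfold reductionHand
  omega

/-- Every successful play sequence of the reduction instance I(G)
consists of exactly m tricks, each of which completes exactly one objective. -/
theorem crew_reduction_success_structure {m : ℕ} (hm : 2 ≤ m)
    (G : SimpleGraph (Fin m)) [DecidableRel G.Adj]
    (f : Fin m → Fin m → ℕ)
    (hf_inj : ∀ i : Fin m, Set.InjOn (f i) (G.neighborFinset i))
    (hf_img : ∀ i : Fin m, (G.neighborFinset i).image (f i) = Finset.Icc 1 (G.degree i))
    (junk : Fin m → Finset Card)
    (hjcard : ∀ i, (junk i).card = m - G.degree i - 1)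
    (hjsuit : ∀ i : Fin m, ∀ c ∈ junk i, m ≤ c.2)
    (hjdist : ∀ (i i' : Fin m) (c c' : Card), c ∈ junk i → c' ∈ junk i' →
      c.2 = c'.2 → i = i' ∧ c = c') :
    ∀ (lead : Fin m) (L : List (Trick m)) (fin : Fin m → Finset Card),
      PlaysFrom (reductionHand G f junk) lead L fin →
      Successful (reductionObjs G) L →
      L.length = m ∧ ∀ t ∈ L, ∃! o, o ∈ reductionObjs G ∧ Completes t o := by
  intro lead L fin hplay hsucc
  have hle : L.length ≤ m :=
    (hplay.length_le_card lead).trans (card_reductionHand_le G f junk lead (hjcard lead))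
  have hcomp (j : Fin m) : ∃ t ∈ L, Completes t (((G.degree j + 1 : ℕ), (j : ℕ)), j) :=
    hsucc _ (Finset.mem_image_of_mem _ (Finset.mem_univ j))
  have huniv : (L.map Trick.winner).toFinset = Finset.univ := by
    ext j
    obtain ⟨t, ht, hc⟩ := hcomp j
    simpa using ⟨t, ht, hc.2⟩
  have hcard : (L.map Trick.winner).toFinset.card = m := by simp [huniv]
  have hge : m ≤ L.length := by
    simpa [hcard] using List.toFinset_card_le (L.map Trick.winner)
  have hlen : L.length = m := le_antisymm hle hge
  have hnodup : (L.map Trick.winner).Nodup :=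
    Multiset.coe_nodup.1 (Multiset.toFinset_card_eq_card_iff_nodup.1 (by
      simpa [hlen] using hcard))
  refine ⟨hlen, fun t ht => ?_⟩
  obtain ⟨t', ht', hc⟩ := hcomp t.winner
  obtain rfl : t' = t := List.inj_on_of_nodup_map hnodup ht' ht hc.2
  refine ⟨_, ⟨Finset.mem_image_of_mem _ (Finset.mem_univ t'.winner), hc⟩, ?_⟩
  rintro o ⟨ho, hco⟩
  obtain ⟨j, -, rfl⟩ := Finset.mem_image.1 ho
  obtain rfl : t'.winner = j := hco.2
  rfl
end
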